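/- Let d ≥ 2 be an integer and let φ : Q → ℝ be twice continuously differentiable. Define φᵍ : Q → ℝ by φᵍ(ū,v̄) = (−ū·v̄)^{−(d−1)/2} · φ(−1/v̄, −1/ū) (note −ū·v̄ > 0 on Q). Then for every (ū,v̄) ∈ Q: □_d φᵍ (ū,v̄) = (−ū·v̄)^{−(d−1)/2} · ū^{−2} · v̄^{−2} · (□_d φ)(−1/v̄, −1/ū), where □_d ψ = −∂₁∂₂ψ + ((d−1)/(2(v−u)))(∂₂ψ − ∂₁ψ) is the spherically symmetric d-dimensional wave operator in null coordinates (applied in the respective variables). -/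

import Mathlib

open Set

/-- The quadrant `Q = {(u,v) : u < 0 < v}` of null coordinates. -/
def Q : Set (ℝ × ℝ) := {p | p.1 < 0 ∧ 0 < p.2}

/-- Partial derivative in the first argument. -/
noncomputable def pd1 (f : ℝ × ℝ → ℝ) (p : ℝ × ℝ) : ℝ :=
  deriv (fun x => f (x, p.2)) p.1

/-- Partial derivative in the second argument. -/
noncomputable def pd2 (f : ℝ × ℝ → ℝ) (p : ℝ × ℝ) : ℝ :=
  deriv (fun y => f (p.1, y)) p.2

/-- The spherically symmetric `d`-dimensional wave operator in null coordinates: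
`□_d ψ = -∂_u∂_v ψ + ((d-1)/(2(v-u)))(∂_v ψ - ∂_u ψ)`. -/
noncomputable def Box (d : ℕ) (f : ℝ × ℝ → ℝ) (p : ℝ × ℝ) : ℝ :=
  -(pd1 (pd2 f) p) + (((d : ℝ) - 1) / (2 * (p.2 - p.1))) * (pd2 f p - pd1 f p)

lemma isOpen_Q : IsOpen Q :=
  (isOpen_lt continuous_fst continuous_const).inter (isOpen_lt continuous_const continuous_snd)

lemma mem_Q_inv {x y : ℝ} (hx : x < 0) (hy : 0 < y) : ((-1 / y, -1 / x) : ℝ × ℝ) ∈ Q :=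
  ⟨div_neg_of_neg_of_pos (by norm_num) hy, div_pos_of_neg_of_neg (by norm_num) hx⟩

lemma hasDerivAt_neg_one_div {x : ℝ} (hx : x ≠ 0) :
    HasDerivAt (fun t : ℝ => -1 / t) (1 / x ^ 2) x := by
  have h := (hasDerivAt_inv hx).neg
  have e : (fun t : ℝ => -1 / t) = -fun y : ℝ => y⁻¹ := by
    funext t
    simp [neg_div]
  rw [neg_neg, ← one_div] at h
  rw [e]
  exact h

lemma hasDerivAt_fst {f : ℝ × ℝ → ℝ} {p : ℝ × ℝ} (h : DifferentiableAt ℝ f p) :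
    HasDerivAt (fun x => f (x, p.2)) (fderiv ℝ f p (1, 0)) p.1 :=
  h.hasFDerivAt.comp_hasDerivAt p.1 ((hasDerivAt_id p.1).prodMk (hasDerivAt_const p.1 p.2))

lemma hasDerivAt_snd {f : ℝ × ℝ → ℝ} {p : ℝ × ℝ} (h : DifferentiableAt ℝ f p) :
    HasDerivAt (fun y => f (p.1, y)) (fderiv ℝ f p (0, 1)) p.2 :=
  h.hasFDerivAt.comp_hasDerivAt p.2 ((hasDerivAt_const p.2 p.1).prodMk (hasDerivAt_id p.2))

lemma weight_snd {a x y : ℝ} (hx : x < 0) (hy : 0 < y) :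
    HasDerivAt (fun t : ℝ => (-(x * t)) ^ a) (a * (-(x * y)) ^ a / y) y := by
  have hpos : 0 < -(x * y) := by nlinarith
  have h1 : HasDerivAt (fun t : ℝ => -(x * t)) (-(x * 1)) y :=
    ((hasDerivAt_id y).const_mul x).neg
  have h := h1.rpow_const (p := a) (Or.inl hpos.ne')
  convert h using 1
  rw [Real.rpow_sub_one hpos.ne']
  field_simp [hx.ne, hy.ne']

lemma weight_fst {a x y : ℝ} (hx : x < 0) (hy : 0 < y) :
    HasDerivAt (fun t : ℝ => (-(t * y)) ^ a) (a * (-(x * y)) ^ a / x) x := by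
  have hpos : 0 < -(x * y) := by nlinarith
  have h1 : HasDerivAt (fun t : ℝ => -(t * y)) (-(1 * y)) x :=
    ((hasDerivAt_id x).mul_const y).neg
  have h := h1.rpow_const (p := a) (Or.inl hpos.ne')
  convert h using 1
  rw [Real.rpow_sub_one hpos.ne']
  field_simp [hx.ne, hy.ne']

theorem stmt5 (d : ℕ) (hd : 2 ≤ d) (φ : ℝ × ℝ → ℝ) (hφ : ContDiffOn ℝ 2 φ Q)
    (ub vb : ℝ) (hub : ub < 0) (hvb : 0 < vb) :
    Box d (fun q => (-(q.1 * q.2)) ^ (-(((d : ℝ) - 1) / 2)) * φ (-1 / q.2, -1 / q.1))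
        (ub, vb) =
      (-(ub * vb)) ^ (-(((d : ℝ) - 1) / 2)) * ub ^ (-2 : ℤ) * vb ^ (-2 : ℤ) *
        Box d φ (-1 / vb, -1 / ub) := by
  have hC : ∀ p ∈ Q, ContDiffAt ℝ 2 φ p := fun p hp => hφ.contDiffAt (isOpen_Q.mem_nhds hp)
  have hD : ∀ p ∈ Q, DifferentiableAt ℝ φ p := fun p hp => (hC p hp).differentiableAt (by norm_num)
  have hDD : ∀ p ∈ Q, DifferentiableAt ℝ (fderiv ℝ φ) p := fun p hp =>
    ((hC p hp).fderiv_right (m := 1) (by norm_num)).differentiableAt (by norm_num)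
  have e1 : ∀ p ∈ Q, pd1 φ p = fderiv ℝ φ p (1, 0) := fun p hp => (hasDerivAt_fst (hD p hp)).deriv
  have e2 : ∀ p ∈ Q, pd2 φ p = fderiv ℝ φ p (0, 1) := fun p hp => (hasDerivAt_snd (hD p hp)).deriv
  have hP : ((-1 / vb, -1 / ub) : ℝ × ℝ) ∈ Q := mem_Q_inv hub hvb
  have e12 : pd1 (pd2 φ) (-1 / vb, -1 / ub)
      = fderiv ℝ (fderiv ℝ φ) (-1 / vb, -1 / ub) (0, 1) (1, 0) := by
    have hsymm : IsSymmSndFDerivAt ℝ φ (-1 / vb, -1 / ub) :=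
      (hC _ hP).isSymmSndFDerivAt (by simp)
    rw [hsymm.eq]
    have h1 : HasDerivAt (fun x => fderiv ℝ φ (x, -1 / ub))
        (fderiv ℝ (fderiv ℝ φ) (-1 / vb, -1 / ub) (1, 0)) (-1 / vb) :=
      (hDD _ hP).hasFDerivAt.comp_hasDerivAt (-1 / vb)
        ((hasDerivAt_id (-1 / vb)).prodMk (hasDerivAt_const (-1 / vb) (-1 / ub)))
    have h2 := h1.clm_apply (hasDerivAt_const (-1 / vb) ((0, 1) : ℝ × ℝ))
    simp only [map_zero, add_zero] at h2
    refine Filter.EventuallyEq.deriv_eq ?_ |>.trans h2.deriv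
    filter_upwards [Iio_mem_nhds hP.1] with x hx
    exact e2 _ ⟨hx, hP.2⟩
  set a : ℝ := -(((d : ℝ) - 1) / 2) with ha
  set ψ : ℝ × ℝ → ℝ := fun q => (-(q.1 * q.2)) ^ a * φ (-1 / q.2, -1 / q.1) with hψ
  -- first derivatives of the transformed function
  have g2 : ∀ x y : ℝ, x < 0 → 0 < y → pd2 ψ (x, y) =
      a * (-(x * y)) ^ a / y * φ (-1 / y, -1 / x) +
        (-(x * y)) ^ a * (1 / y ^ 2 * fderiv ℝ φ (-1 / y, -1 / x) (1, 0)) := by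
    intro x y hx hy
    have h1 := hasDerivAt_fst (hD _ (mem_Q_inv hx hy))
    have h2 := h1.comp y (hasDerivAt_neg_one_div hy.ne')
    have h3 := (weight_snd (a := a) hx hy).mul h2
    rw [mul_comm (1 / y ^ 2)]
    exact h3.deriv
  have c2 : ∀ x y : ℝ, x < 0 → 0 < y → HasDerivAt (fun t => φ (-1 / y, -1 / t))
      (fderiv ℝ φ (-1 / y, -1 / x) (0, 1) * (1 / x ^ 2)) x := by
    intro x y hx hy
    have h1 := hasDerivAt_snd (hD _ (mem_Q_inv hx hy))
    exact h1.comp x (hasDerivAt_neg_one_div hx.ne)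
  have g1 : pd1 ψ (ub, vb) =
      a * (-(ub * vb)) ^ a / ub * φ (-1 / vb, -1 / ub) +
        (-(ub * vb)) ^ a * (fderiv ℝ φ (-1 / vb, -1 / ub) (0, 1) * (1 / ub ^ 2)) :=
    ((weight_fst (a := a) hub hvb).mul (c2 ub vb hub hvb)).deriv
  have g12 : pd1 (pd2 ψ) (ub, vb) =
      (a * (a * (-(ub * vb)) ^ a / ub) / vb * φ (-1 / vb, -1 / ub) +
        a * (-(ub * vb)) ^ a / vb * (fderiv ℝ φ (-1 / vb, -1 / ub) (0, 1) * (1 / ub ^ 2))) +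
      (a * (-(ub * vb)) ^ a / ub * (1 / vb ^ 2 * fderiv ℝ φ (-1 / vb, -1 / ub) (1, 0)) +
        (-(ub * vb)) ^ a * (1 / vb ^ 2 *
          (fderiv ℝ (fderiv ℝ φ) (-1 / vb, -1 / ub) (0, 1) (1, 0) * (1 / ub ^ 2)))) := by
    have hw := weight_fst (a := a) hub hvb
    have k1 : HasDerivAt (fun t => fderiv ℝ φ (-1 / vb, t))
        (fderiv ℝ (fderiv ℝ φ) (-1 / vb, -1 / ub) (0, 1)) (-1 / ub) :=
      (hDD _ hP).hasFDerivAt.comp_hasDerivAt (-1 / ub)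
        ((hasDerivAt_const (-1 / ub) (-1 / vb)).prodMk (hasDerivAt_id (-1 / ub)))
    have k2 := k1.clm_apply (hasDerivAt_const (-1 / ub) ((1, 0) : ℝ × ℝ))
    simp only [map_zero, add_zero] at k2
    have k3 := k2.comp ub (hasDerivAt_neg_one_div hub.ne)
    have k4 := (((hw.const_mul a).div_const vb).mul (c2 ub vb hub hvb)).add
      (hw.mul (k3.const_mul (1 / vb ^ 2)))
    refine Filter.EventuallyEq.deriv_eq ?_ |>.trans k4.deriv
    filter_upwards [Iio_mem_nhds hub] with x hx
    exact g2 x vb hx hvb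
  unfold Box
  rw [g12, g1, g2 ub vb hub hvb, e12, e1 _ hP, e2 _ hP]
  have hk : (d : ℝ) - 1 = -2 * a := by rw [ha]; ring
  rw [hk]
  generalize (-(ub * vb)) ^ a = w
  generalize fderiv ℝ (fderiv ℝ φ) (-1 / vb, -1 / ub) (0, 1) (1, 0) = F
  generalize fderiv ℝ φ (-1 / vb, -1 / ub) (0, 1) = B
  generalize fderiv ℝ φ (-1 / vb, -1 / ub) (1, 0) = A
  generalize φ (-1 / vb, -1 / ub) = f
  have hu := hub.ne
  have hv := hvb.ne'
  have hr : vb - ub ≠ 0 := by linarith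
  have hr2 : -1 / ub - -1 / vb = -(vb - ub) / (ub * vb) := by field_simp; ring
  have z : ∀ t : ℝ, t ^ (-2 : ℤ) = 1 / t ^ 2 := by
    intro t
    rw [zpow_neg, one_div]
    norm_cast
  simp only [hr2, z]
  field_simp
  ring
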